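/- arXiv:1812.03093 — 2 statements merged into one kernel-verified Lean document; each statement's English description precedes it below -/
import Mathlib

section
/- Let (X,M,*) be a fuzzy metric space such that the set X' of all accumulation points of (X,τ_M) is compact and, for every r ∈ (0,1) and s > 0, the set X \ B(X',r,s) is fuzzy uniformly discrete in (X,M,*). Then for every δ₁ ∈ (0,1) and t₁ > 0 there exist δ₂ ∈ (0,1) and t₂ > 0 such that for each x ∈ X with sup_{a∈X'} M(x,a,t₁) ≤ 1−δ₁ one has sup_{y≠x} M(x,y,t₂) ≤ 1−δ₂. -/
open Filter Topology Set

/-- A fuzzy metric space in the sense of George and Veeramani: a continuous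
t-norm `star` on `[0,1]` together with a fuzzy set `M` on `X × X × (0,∞)`. -/
structure FuzzyMetric (X : Type*) where
  M : X → X → ℝ → ℝ
  star : ℝ → ℝ → ℝ
  star_mem : ∀ a ∈ Set.Icc (0:ℝ) 1, ∀ b ∈ Set.Icc (0:ℝ) 1, star a b ∈ Set.Icc (0:ℝ) 1
  star_comm : ∀ a ∈ Set.Icc (0:ℝ) 1, ∀ b ∈ Set.Icc (0:ℝ) 1, star a b = star b a
  star_assoc : ∀ a ∈ Set.Icc (0:ℝ) 1, ∀ b ∈ Set.Icc (0:ℝ) 1, ∀ c ∈ Set.Icc (0:ℝ) 1,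
    star (star a b) c = star a (star b c)
  star_one : ∀ a ∈ Set.Icc (0:ℝ) 1, star a 1 = a
  star_mono : ∀ a b c d : ℝ, a ∈ Set.Icc (0:ℝ) 1 → b ∈ Set.Icc (0:ℝ) 1 →
    c ∈ Set.Icc (0:ℝ) 1 → d ∈ Set.Icc (0:ℝ) 1 → a ≤ b → c ≤ d → star a c ≤ star b d
  star_continuous : ContinuousOn (fun p : ℝ × ℝ => star p.1 p.2)
    (Set.Icc (0:ℝ) 1 ×ˢ Set.Icc (0:ℝ) 1)
  M_pos : ∀ x y t, 0 < t → 0 < M x y t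
  M_le_one : ∀ x y t, 0 < t → M x y t ≤ 1
  M_eq_one_iff : ∀ x y t, 0 < t → (M x y t = 1 ↔ x = y)
  M_symm : ∀ x y t, 0 < t → M x y t = M y x t
  M_triangle : ∀ x y z t s, 0 < t → 0 < s → star (M x y t) (M y z s) ≤ M x z (t + s)
  M_continuousOn : ∀ x y, ContinuousOn (M x y) (Set.Ioi (0:ℝ))

namespace FuzzyMetric

variable {X : Type*}

/-- The open ball `B(x,r,t)`. -/
def ball (F : FuzzyMetric X) (x : X) (r t : ℝ) : Set X := {y | 1 - r < F.M x y t}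

/-- The topology `τ_M` induced by the fuzzy metric (the balls form a base for it). -/
def topology (F : FuzzyMetric X) : TopologicalSpace X :=
  TopologicalSpace.generateFrom
    {s | ∃ x : X, ∃ r t : ℝ, r ∈ Set.Ioo (0:ℝ) 1 ∧ 0 < t ∧ s = F.ball x r t}

/-- `f : X → ℝ` is `ℝ`-uniformly continuous. -/
def RUniformlyContinuous (F : FuzzyMetric X) (f : X → ℝ) : Prop :=
  ∀ ε > (0:ℝ), ∃ r ∈ Set.Ioo (0:ℝ) 1, ∃ s > (0:ℝ),
    ∀ x y : X, 1 - r < F.M x y s → |f x - f y| < ε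

/-- The Lebesgue property: every open cover is refined by the family of balls of
some fixed radius `r` and parameter `t`. -/
def Lebesgue (F : FuzzyMetric X) : Prop :=
  ∀ 𝒢 : Set (Set X), (∀ G ∈ 𝒢, F.topology.IsOpen G) → ⋃₀ 𝒢 = Set.univ →
    ∃ r ∈ Set.Ioo (0:ℝ) 1, ∃ t > (0:ℝ), ∀ x : X, ∃ G ∈ 𝒢, F.ball x r t ⊆ G

/-- A set `A ⊆ X` is fuzzy uniformly discrete. -/
def UniformlyDiscrete (F : FuzzyMetric X) (A : Set X) : Prop :=
  ∃ r ∈ Set.Ioo (0:ℝ) 1, ∃ s > (0:ℝ), ∀ x ∈ A, ∀ y ∈ A, x ≠ y → F.M x y s < 1 - r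

/-- The set `X'` of accumulation points of `(X, τ_M)`. -/
def derivedSet (F : FuzzyMetric X) : Set X :=
  {x | ∀ U : Set X, F.topology.IsOpen U → x ∈ U → ∃ y ∈ U, y ≠ x}

/-- A sequence is Cauchy in the fuzzy metric. -/
def IsCauchy (F : FuzzyMetric X) (u : ℕ → X) : Prop :=
  ∀ ε ∈ Set.Ioo (0:ℝ) 1, ∀ t > (0:ℝ), ∃ k : ℕ, ∀ m ≥ k, ∀ n ≥ k, 1 - ε < F.M (u m) (u n) t

/-- Sequential compactness: every sequence has a convergent subsequence. -/
def SeqCompact (F : FuzzyMetric X) : Prop :=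
  ∀ u : ℕ → X, ∃ x : X, ∃ φ : ℕ → ℕ, StrictMono φ ∧
    Filter.Tendsto (u ∘ φ) Filter.atTop (@nhds X F.topology x)

end FuzzyMetric

namespace FuzzyMetric

variable {X : Type*}

lemma M_mem_Icc (F : FuzzyMetric X) (x y : X) {t : ℝ} (ht : 0 < t) :
    F.M x y t ∈ Set.Icc (0:ℝ) 1 :=
  ⟨(F.M_pos x y t ht).le, F.M_le_one x y t ht⟩

lemma M_mono (F : FuzzyMetric X) (x y : X) {t t' : ℝ} (ht : 0 < t) (h : t ≤ t') :
    F.M x y t ≤ F.M x y t' := by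
  rcases h.eq_or_lt with rfl | h
  · rfl
  · have key := F.M_triangle x y y t (t' - t) ht (sub_pos.2 h)
    rwa [(F.M_eq_one_iff y y _ (sub_pos.2 h)).2 rfl, F.star_one _ (F.M_mem_Icc x y ht),
      add_sub_cancel] at key

/-- By continuity of the t-norm at `(1,1)`, `(1-r) * (1-r)` is arbitrarily close to `1`. -/
lemma exists_lt_star_self (F : FuzzyMetric X) {c : ℝ} (hc : c < 1) :
    ∃ r ∈ Set.Ioo (0:ℝ) 1, c < F.star (1 - r) (1 - r) := by
  have hmaps : ∀ u ∈ Set.Icc (0:ℝ) 1, ((1 - u, 1 - u) : ℝ × ℝ) ∈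
      Set.Icc (0:ℝ) 1 ×ˢ Set.Icc (0:ℝ) 1 := fun u hu =>
    have h : 1 - u ∈ Set.Icc (0:ℝ) 1 := ⟨by linarith [hu.2], by linarith [hu.1]⟩
    ⟨h, h⟩
  have hcont : ContinuousOn (fun u : ℝ => F.star (1 - u) (1 - u)) (Set.Icc 0 1) :=
    F.star_continuous.comp (f := fun u : ℝ => ((1 - u, 1 - u) : ℝ × ℝ)) (by fun_prop) hmaps
  have hlim := (hcont 0 (by simp)).tendsto.mono_left
    (nhdsWithin_mono 0 (Set.Ioo_subset_Icc_self : Set.Ioo (0:ℝ) 1 ⊆ _))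
  have hlt : c < F.star (1 - 0) (1 - 0) := by
    rwa [sub_zero, F.star_one 1 (by simp)]
  have : (𝓝[Set.Ioo (0:ℝ) 1] 0).NeBot := left_nhdsWithin_Ioo_neBot one_pos
  obtain ⟨r, hr, hmem⟩ := ((hlim.eventually (lt_mem_nhds hlt)).and self_mem_nhdsWithin).exists
  exact ⟨r, hmem, hr⟩

end FuzzyMetric

/-- If `X'` is compact and every `X \ B(X',r,s)` is fuzzy uniformly discrete, then for
all `δ₁ ∈ (0,1)`, `t₁ > 0` there exist `δ₂ ∈ (0,1)`, `t₂ > 0` such that every `x` with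
`sup_{a ∈ X'} M(x,a,t₁) ≤ 1 - δ₁` satisfies `sup_{y ≠ x} M(x,y,t₂) ≤ 1 - δ₂`. -/
theorem isolation_of_derivedSet_compact {X : Type*} [Nonempty X] (F : FuzzyMetric X)
    (hc : @IsCompact X F.topology F.derivedSet)
    (hud : ∀ r ∈ Set.Ioo (0:ℝ) 1, ∀ s > (0:ℝ),
      F.UniformlyDiscrete ((⋃ a ∈ F.derivedSet, F.ball a r s)ᶜ)) :
    ∀ δ₁ ∈ Set.Ioo (0:ℝ) 1, ∀ t₁ > (0:ℝ), ∃ δ₂ ∈ Set.Ioo (0:ℝ) 1, ∃ t₂ > (0:ℝ),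
      ∀ x : X, (∀ a ∈ F.derivedSet, F.M x a t₁ ≤ 1 - δ₁) →
        ∀ y : X, y ≠ x → F.M x y t₂ ≤ 1 - δ₂ := by
  intro δ₁ hδ₁ t₁ ht₁
  obtain ⟨r, hr, hlt⟩ := F.exists_lt_star_self (show 1 - δ₁ < 1 by linarith [hδ₁.1])
  have hs : 0 < t₁ / 2 := half_pos ht₁
  have hr' : 1 - r ∈ Set.Icc (0:ℝ) 1 := ⟨by linarith [hr.2], by linarith [hr.1]⟩
  have hr_lt : 1 - δ₁ < 1 - r := hlt.trans_le <|
    (F.star_mono _ _ _ 1 hr' hr' hr' (by simp) le_rfl hr'.2).trans_eq (F.star_one _ hr')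
  obtain ⟨r₀, hr₀, s₀, hs₀, hdisc⟩ := hud r hr (t₁ / 2) hs
  have ht₂ : 0 < min (t₁ / 2) s₀ := lt_min hs hs₀
  refine ⟨min r r₀, ⟨lt_min hr.1 hr₀.1, min_lt_of_left_lt hr.2⟩, min (t₁ / 2) s₀, ht₂,
    fun x hx y hyx => ?_⟩
  by_cases hy : y ∈ ⋃ a ∈ F.derivedSet, F.ball a r (t₁ / 2)
  · simp only [Set.mem_iUnion] at hy
    obtain ⟨a, ha, hay⟩ := hy
    have hay : 1 - r < F.M y a (t₁ / 2) := by
      rw [F.M_symm y a _ hs]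
      exact hay
    by_contra! hxy
    have hxy' : 1 - r ≤ F.M x y (t₁ / 2) := by
      linarith [F.M_mono x y ht₂ (min_le_left _ _), min_le_left r r₀]
    have htri := F.M_triangle x y a _ _ hs hs
    rw [add_halves] at htri
    linarith [hx a ha, F.star_mono _ _ _ _ hr' (F.M_mem_Icc x y hs) hr' (F.M_mem_Icc y a hs)
      hxy' hay.le]
  · have hxA : x ∉ ⋃ a ∈ F.derivedSet, F.ball a r (t₁ / 2) := by
      simp only [Set.mem_iUnion, not_exists]
      intro a ha hax
      have hax : 1 - r < F.M x a (t₁ / 2) := by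
        rw [F.M_symm x a _ hs]
        exact hax
      linarith [hx a ha, F.M_mono x a hs (half_le_self ht₁.le)]
    linarith [hdisc x hxA y hy hyx.symm, F.M_mono x y ht₂ (min_le_right _ _),
      min_le_right r r₀]
end

section
/- A fuzzy metric space (X,M,*) is Lebesgue if and only if the set X' of all accumulation points of (X,τ_M) is compact and, for every r ∈ (0,1) and s > 0, the set X \ B(X',r,s) is fuzzy uniformly discrete in (X,M,*), where B(X',r,s) = ⋃_{a∈X'} B(a,r,s). -/
open Filter Topology Set

open scoped Uniformity

section UniformSpace

open UniformSpace

variable {X : Type*} [UniformSpace X]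

/-- If every open cover of a T₁ uniform space is refined by the balls of a single entourage, then
a sequence having distinct terms arbitrarily close to it has a cluster point. -/
theorem exists_mapClusterPt_of_lebesgue [T1Space X]
    (h : ∀ 𝒢 : Set (Set X), (∀ G ∈ 𝒢, IsOpen G) → ⋃₀ 𝒢 = univ →
      ∃ V ∈ 𝓤 X, ∀ x, ∃ G ∈ 𝒢, ball x V ⊆ G)
    {x y : ℕ → X} (hne : ∀ n, x n ≠ y n)
    (hxy : Tendsto (fun n => (x n, y n)) atTop (𝓤 X)) :
    ∃ p, MapClusterPt p atTop x := by
  by_contra! hp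
  obtain ⟨V, hV, hVG⟩ := h {G | IsOpen G ∧ ∀ n, x n ∈ G → y n ∉ G} (fun G hG => hG.1) (by
    refine eq_univ_of_forall fun p => ?_
    have hp' := hp p
    simp only [mapClusterPt_iff_frequently, not_forall, not_frequently, exists_prop] at hp'
    obtain ⟨s, hs, hev⟩ := hp'
    obtain ⟨O, hOs, hO, hpO⟩ := _root_.mem_nhds_iff.1 hs
    obtain ⟨N, hN⟩ := eventually_atTop.1 hev
    set T : Set X := (x '' Iio N ∪ y '' Iio N) \ {p}
    have hT : T.Finite := (((finite_Iio N).image x).union ((finite_Iio N).image y)).sdiff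
    refine ⟨O \ T, ⟨hO.sdiff hT.isClosed, fun n hx hy => ?_⟩, hpO, fun h => h.2 rfl⟩
    have hn : n < N := by
      by_contra! hn
      exact hN n hn (hOs hx.1)
    have hxp : x n = p := by
      by_contra hxp
      exact hx.2 ⟨Or.inl ⟨n, hn, rfl⟩, hxp⟩
    have hyp : y n = p := by
      by_contra hyp
      exact hy.2 ⟨Or.inr ⟨n, hn, rfl⟩, hyp⟩
    exact hne n (hxp.trans hyp.symm))
  obtain ⟨n, hn⟩ := (hxy.eventually_mem hV).exists
  obtain ⟨G, hG, hVG⟩ := hVG (x n)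
  exact hG.2 n (hVG (mem_ball_self _ hV)) (hVG hn)

/-- In a T₁ uniform space with countably generated uniformity, the Lebesgue property is equivalent
to compactness of the set of non-isolated points together with uniform discreteness of the
complement of each of its uniform neighbourhoods. -/
theorem lebesgue_iff_isCompact_setOf_not_isOpen_singleton [T1Space X] [(𝓤 X).IsCountablyGenerated] :
    (∀ 𝒢 : Set (Set X), (∀ G ∈ 𝒢, IsOpen G) → ⋃₀ 𝒢 = univ →
      ∃ V ∈ 𝓤 X, ∀ x, ∃ G ∈ 𝒢, ball x V ⊆ G) ↔
    IsCompact {x : X | ¬IsOpen {x}} ∧ ∀ V ∈ 𝓤 X, ∃ W ∈ 𝓤 X,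
      ∀ x ∈ (⋃ a ∈ {x : X | ¬IsOpen {x}}, ball a V)ᶜ,
      ∀ y ∈ (⋃ a ∈ {x : X | ¬IsOpen {x}}, ball a V)ᶜ, x ≠ y → (x, y) ∉ W := by
  constructor
  · refine fun h => ⟨?_, fun V hV => ?_⟩
    · refine IsSeqCompact.isCompact fun x hx => ?_
      obtain ⟨V, hV⟩ := (𝓤 X).exists_antitone_basis
      have hy : ∀ n, ∃ y, x n ≠ y ∧ (x n, y) ∈ V n := by
        intro n
        by_contra! hn
        refine hx n (isOpen_singleton_iff_nhds_eq_pure _ |>.2 (le_antisymm ?_ (pure_le_nhds _)))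
        refine le_pure_iff.2 (mem_of_superset (ball_mem_nhds (x n) (hV.1.mem_of_mem (i := n) trivial))
          fun y hy => ?_)
        by_contra hne
        exact hn y (Ne.symm hne) hy
      choose y hne hy using hy
      obtain ⟨p, hp⟩ := exists_mapClusterPt_of_lebesgue h hne (hV.tendsto hy)
      refine ⟨p, fun hop => ?_, hp.tendsto_subseq⟩
      obtain ⟨n, hn⟩ := (hp.frequently (hop.mem_nhds rfl)).exists
      exact hx n (by rwa [mem_singleton_iff.1 hn])
    · obtain ⟨W, hW, hWG⟩ := h
        {G | IsOpen G ∧ ((∃ p, G = {p}) ∨ ∃ a, ¬IsOpen {a} ∧ G ⊆ ball a V)}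
        (fun G hG => hG.1) (by
          refine eq_univ_of_forall fun p => ?_
          by_cases hp : IsOpen {p}
          · exact ⟨{p}, ⟨hp, Or.inl ⟨p, rfl⟩⟩, rfl⟩
          · exact ⟨interior (ball p V), ⟨isOpen_interior, Or.inr ⟨p, hp, interior_subset⟩⟩,
              mem_interior_iff_mem_nhds.2 (ball_mem_nhds p hV)⟩)
      refine ⟨W, hW, fun x hx y _ hne hxy => ?_⟩
      obtain ⟨G, ⟨-, ⟨p, rfl⟩ | ⟨a, ha, hG⟩⟩, hWG⟩ := hWG x
      · exact hne ((hWG (mem_ball_self x hW)).trans (hWG hxy : y = p).symm)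
      · exact hx (mem_biUnion ha (hG (hWG (mem_ball_self x hW))))
  · rintro ⟨hc, hd⟩ 𝒢 hG hU
    obtain ⟨V, hV, hVG⟩ := lebesgue_number_lemma_sUnion hc hG (hU ▸ subset_univ _)
    obtain ⟨W, hW, hWs, hWV⟩ := comp_comp_symm_mem_uniformity_sets hV
    obtain ⟨D, hD, hDW⟩ := hd W hW
    refine ⟨D ∩ W, inter_mem hD hW, fun x => ?_⟩
    by_cases hx : ∃ a, ¬IsOpen {a} ∧ ∃ z, z ∈ ball a W ∧ x ∈ ball z W
    · obtain ⟨a, ha, z, haz, hzx⟩ := hx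
      obtain ⟨G, hG', hVG⟩ := hVG a ha
      exact ⟨G, hG', fun y hy => hVG (hWV (mem_ball_comp (mem_ball_comp haz hzx) hy.2))⟩
    · obtain ⟨G, hG', hxG⟩ : x ∈ ⋃₀ 𝒢 := hU ▸ mem_univ x
      refine ⟨G, hG', fun y hy => ?_⟩
      by_cases hxy : x = y
      · exact hxy ▸ hxG
      refine absurd hy.1 (hDW x ?_ y ?_ hxy)
      · simp only [mem_compl_iff, mem_iUnion, not_exists]
        exact fun a ha hxa => hx ⟨a, ha, x, hxa, mem_ball_self x hW⟩
      · simp only [mem_compl_iff, mem_iUnion, not_exists]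
        exact fun a ha hya => hx ⟨a, ha, y, hya, mem_ball_symmetry.1 hy.2⟩

end UniformSpace

namespace FuzzyMetric

variable {X : Type*} (F : FuzzyMetric X)

theorem M_mem (x y : X) {t : ℝ} (ht : 0 < t) : F.M x y t ∈ Icc (0 : ℝ) 1 :=
  ⟨(F.M_pos x y t ht).le, F.M_le_one x y t ht⟩

theorem M_self (x : X) {t : ℝ} (ht : 0 < t) : F.M x x t = 1 := (F.M_eq_one_iff x x t ht).2 rfl

theorem M_mono_s11 (x y : X) {s t : ℝ} (hs : 0 < s) (hst : s ≤ t) : F.M x y s ≤ F.M x y t := by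
  obtain rfl | hst := hst.eq_or_lt
  · rfl
  · have h := F.M_triangle x y y s (t - s) hs (sub_pos.2 hst)
    rwa [F.M_self y (sub_pos.2 hst), F.star_one _ (F.M_mem x y hs), add_sub_cancel] at h

theorem exists_lt_star {a c : ℝ} (ha : a ∈ Icc (0 : ℝ) 1) (hc : c < a) :
    ∃ r ∈ Ioo (0 : ℝ) 1, c < F.star a (1 - r) := by
  have hcont : ContinuousOn (fun b => F.star a b) (Icc 0 1) :=
    F.star_continuous.comp (f := fun b => (a, b)) (by fun_prop) fun b hb => ⟨ha, hb⟩
  have hev : ∀ᶠ b in 𝓝[Icc 0 1] (1 : ℝ), c < F.star a b :=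
    (hcont 1 (right_mem_Icc.2 zero_le_one)).eventually_const_lt (hc.trans_eq (F.star_one a ha).symm)
  have htend : Tendsto (fun r : ℝ => 1 - r) (𝓝[>] 0) (𝓝[Icc 0 1] 1) := by
    refine tendsto_nhdsWithin_iff.2 ⟨?_, ?_⟩
    · exact ((continuous_const.sub continuous_id).tendsto' 0 1 (by simp)).mono_left
        nhdsWithin_le_nhds
    · filter_upwards [Ioo_mem_nhdsGT (zero_lt_one' ℝ)] with r hr
      exact ⟨by linarith [hr.2], by linarith [hr.1]⟩
  obtain ⟨r, hr, hr'⟩ := ((htend.eventually hev).and (Ioo_mem_nhdsGT (zero_lt_one' ℝ))).exists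
  exact ⟨r, hr', hr⟩

theorem exists_lt_star_self_s11 {r : ℝ} (hr : r ∈ Ioo (0 : ℝ) 1) :
    ∃ q ∈ Ioo (0 : ℝ) 1, 1 - r < F.star (1 - q) (1 - q) := by
  have ha : 1 - r / 2 ∈ Icc (0 : ℝ) 1 := ⟨by linarith [hr.2], by linarith [hr.1]⟩
  obtain ⟨q, hq, h⟩ := F.exists_lt_star ha (c := 1 - r) (by linarith [hr.1])
  have h0 : 0 < min (r / 2) q := lt_min (by linarith [hr.1]) hq.1
  have h1 : min (r / 2) q < 1 := (min_le_right _ _).trans_lt hq.2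
  have hm : 1 - min (r / 2) q ∈ Icc (0 : ℝ) 1 := ⟨by linarith, by linarith⟩
  exact ⟨_, ⟨h0, h1⟩, h.trans_le (F.star_mono _ _ _ _ ha hm
    ⟨by linarith [hq.2], by linarith [hq.1]⟩ hm
    (by linarith [min_le_left (r / 2) q]) (by linarith [min_le_right (r / 2) q]))⟩

/-- The basic entourages of a fuzzy metric. -/
def entourage (p : ℝ × ℝ) : Set (X × X) := {q | 1 - p.1 < F.M q.1 q.2 p.2}

theorem entourage_mono {r s t u : ℝ} (ht : 0 < t) (hrs : r ≤ s) (htu : t ≤ u) :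
    F.entourage (r, t) ⊆ F.entourage (s, u) := fun q hq =>
  (sub_le_sub_left hrs 1).trans_lt (lt_of_lt_of_le hq (F.M_mono_s11 q.1 q.2 ht htu))

/-- The filter basis of basic entourages. -/
def filterBasis : FilterBasis (X × X) where
  sets := F.entourage '' (Ioo 0 1 ×ˢ Ioi 0)
  nonempty := ⟨_, mem_image_of_mem _ (show ((1 / 2, 1) : ℝ × ℝ) ∈ _ by norm_num)⟩
  inter_sets := by
    rintro _ _ ⟨⟨r, t⟩, ⟨hr, ht⟩, rfl⟩ ⟨⟨s, u⟩, ⟨hs, hu⟩, rfl⟩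
    have htu : 0 < min t u := lt_min ht hu
    exact ⟨_, mem_image_of_mem _ (show (min r s, min t u) ∈ _ from
      ⟨⟨lt_min hr.1 hs.1, (min_le_left r s).trans_lt hr.2⟩, htu⟩), subset_inter
      (F.entourage_mono htu (min_le_left _ _) (min_le_left _ _))
      (F.entourage_mono htu (min_le_right _ _) (min_le_right _ _))⟩

/-- The uniform structure of a fuzzy metric space. -/
abbrev uniformSpace : UniformSpace X :=
  UniformSpace.ofCore <| UniformSpace.Core.mkOfBasis F.filterBasis
    (by
      rintro _ ⟨⟨r, t⟩, ⟨hr, ht⟩, rfl⟩ x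
      simpa [entourage, F.M_self x ht] using hr.1)
    (by
      rintro _ ⟨⟨r, t⟩, ⟨hr, ht⟩, rfl⟩
      refine ⟨_, mem_image_of_mem _ ⟨hr, ht⟩, fun q hq => ?_⟩
      exact lt_of_lt_of_eq hq (F.M_symm _ _ _ ht))
    (by
      rintro _ ⟨⟨r, t⟩, ⟨hr, ht⟩, rfl⟩
      obtain ⟨q, hq, h⟩ := F.exists_lt_star_self_s11 hr
      have ht2 : 0 < t / 2 := half_pos ht
      refine ⟨_, mem_image_of_mem _ (show (q, t / 2) ∈ _ from ⟨hq, ht2⟩), ?_⟩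
      rintro ⟨x, z⟩ ⟨y, hxy, hyz⟩
      have hq1 : 1 - q ∈ Icc (0 : ℝ) 1 := ⟨by linarith [hq.2], by linarith [hq.1]⟩
      have htri := F.M_triangle x y z _ _ ht2 ht2
      rw [add_halves] at htri
      exact h.trans_le ((F.star_mono _ _ _ _ hq1 (F.M_mem x y ht2) hq1 (F.M_mem y z ht2)
        (le_of_lt hxy) (le_of_lt hyz)).trans htri))

theorem hasBasis_uniformity :
    (𝓤[F.uniformSpace]).HasBasis (fun p : ℝ × ℝ => p ∈ Ioo (0 : ℝ) 1 ×ˢ Ioi (0 : ℝ))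
      F.entourage := by
  refine ⟨fun s => F.filterBasis.hasBasis.mem_iff.trans ?_⟩
  exact exists_mem_image

theorem isCountablyGenerated_uniformity : (𝓤[F.uniformSpace]).IsCountablyGenerated := by
  have h : (𝓤[F.uniformSpace]).HasBasis (fun _ : ℕ => True)
      (fun n => F.entourage (1 / ((n : ℝ) + 2), 1 / ((n : ℝ) + 2))) := by
    refine F.hasBasis_uniformity.to_hasBasis ?_ ?_
    · rintro ⟨r, t⟩ ⟨hr, ht⟩
      obtain ⟨n, hn⟩ := exists_nat_one_div_lt (lt_min hr.1 ht)
      have hn' : 1 / ((n : ℝ) + 2) ≤ min r t :=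
        (one_div_le_one_div_of_le (by positivity) (by linarith)).trans hn.le
      exact ⟨n, trivial, F.entourage_mono (by positivity) (hn'.trans (min_le_left _ _))
        (hn'.trans (min_le_right _ _))⟩
    · refine fun n _ => ⟨_, ⟨⟨by positivity, ?_⟩, by simp only [mem_Ioi]; positivity⟩, Subset.rfl⟩
      rw [div_lt_one (by positivity)]
      linarith [n.cast_nonneg (α := ℝ)]
  exact h.isCountablyGenerated

theorem isOpen_ball (x : X) {r t : ℝ} (ht : 0 < t) :
    IsOpen[F.uniformSpace.toTopologicalSpace] (F.ball x r t) := by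
  let := F.uniformSpace
  refine isOpen_iff_mem_nhds.2 fun y hy => ?_
  have hcont : ContinuousAt (F.M x y) t := (F.M_continuousOn x y).continuousAt (Ioi_mem_nhds ht)
  have hev := ((hcont.eventually_const_lt hy).filter_mono nhdsWithin_le_nhds).and
    (Ioo_mem_nhdsLT ht)
  obtain ⟨s, hs, hs0, hst⟩ := hev.exists
  obtain ⟨q, hq, h⟩ := F.exists_lt_star (F.M_mem x y hs0) hs
  have hu : 0 < t - s := sub_pos.2 hst
  refine mem_of_superset (UniformSpace.ball_mem_nhds y
    (F.hasBasis_uniformity.mem_of_mem (i := (q, t - s)) ⟨hq, hu⟩)) fun z hz => ?_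
  have htri := F.M_triangle x y z _ _ hs0 hu
  rw [add_sub_cancel] at htri
  exact h.trans_le ((F.star_mono _ _ _ _ (F.M_mem x y hs0) (F.M_mem x y hs0)
    ⟨by linarith [hq.2], by linarith [hq.1]⟩ (F.M_mem y z hu) le_rfl (le_of_lt hz)).trans htri)

theorem topology_eq : F.topology = F.uniformSpace.toTopologicalSpace := by
  refine le_antisymm (fun s hs => ?_) (le_generateFrom ?_)
  · refine (@isOpen_iff_mem_nhds X F.topology s).2 fun x hx => ?_
    obtain ⟨V, hV, hVs⟩ := (@isOpen_iff_ball_subset _ F.uniformSpace _).1 hs x hx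
    let := F.topology
    obtain ⟨⟨r, t⟩, ⟨hr, ht⟩, hrt⟩ := F.hasBasis_uniformity.mem_iff.1 hV
    have hopen : IsOpen (F.ball x r t) :=
      TopologicalSpace.isOpen_generateFrom_of_mem ⟨x, r, t, hr, ht, rfl⟩
    refine mem_of_superset (hopen.mem_nhds ?_) fun y hy => hVs (hrt hy)
    simpa [ball, F.M_self x ht] using hr.1
  · rintro _ ⟨x, r, t, -, ht, rfl⟩
    exact F.isOpen_ball x ht

theorem t0Space : @T0Space X F.uniformSpace.toTopologicalSpace := by
  let := F.uniformSpace
  refine t0Space_iff_uniformity.2 fun x y h => ?_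
  by_contra hne
  have hlt : F.M x y 1 < 1 :=
    (F.M_le_one x y 1 one_pos).lt_of_ne fun h => hne ((F.M_eq_one_iff x y 1 one_pos).1 h)
  have hpos := F.M_pos x y 1 one_pos
  have := h _ (F.hasBasis_uniformity.mem_of_mem (i := (1 - F.M x y 1, 1))
    ⟨⟨by linarith, by linarith⟩, one_pos (α := ℝ)⟩)
  simp [entourage] at this

theorem lebesgue_iff :
    F.Lebesgue ↔ ∀ 𝒢 : Set (Set X), (∀ G ∈ 𝒢, IsOpen[F.uniformSpace.toTopologicalSpace] G) →
      ⋃₀ 𝒢 = univ → ∃ V ∈ 𝓤[F.uniformSpace], ∀ x, ∃ G ∈ 𝒢, UniformSpace.ball x V ⊆ G := by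
  rw [Lebesgue, F.topology_eq]
  refine forall₃_congr fun 𝒢 _ _ => ⟨?_, ?_⟩
  · rintro ⟨r, hr, t, ht, h⟩
    exact ⟨_, F.hasBasis_uniformity.mem_of_mem (i := (r, t)) ⟨hr, ht⟩, h⟩
  · rintro ⟨V, hV, h⟩
    obtain ⟨⟨r, t⟩, ⟨hr, ht⟩, hrt⟩ := F.hasBasis_uniformity.mem_iff.1 hV
    refine ⟨r, hr, t, ht, fun x => ?_⟩
    obtain ⟨G, hG, hVG⟩ := h x
    exact ⟨G, hG, fun y hy => hVG (hrt hy)⟩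

theorem uniformlyDiscrete_iff (A : Set X) :
    F.UniformlyDiscrete A ↔
      ∃ W ∈ 𝓤[F.uniformSpace], ∀ x ∈ A, ∀ y ∈ A, x ≠ y → (x, y) ∉ W := by
  constructor
  · rintro ⟨r, hr, s, hs, h⟩
    exact ⟨_, F.hasBasis_uniformity.mem_of_mem (i := (r, s)) ⟨hr, hs⟩,
      fun x hx y hy hne => (h x hx y hy hne).not_gt⟩
  · rintro ⟨W, hW, h⟩
    obtain ⟨⟨r, s⟩, ⟨hr, hs⟩, hrs⟩ := F.hasBasis_uniformity.mem_iff.1 hW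
    refine ⟨r / 2, ⟨half_pos hr.1, by linarith [hr.1, hr.2]⟩, s, hs, fun x hx y hy hne => ?_⟩
    have : F.M x y s ≤ 1 - r := not_lt.1 fun hlt => h x hx y hy hne (hrs hlt)
    linarith [hr.1]

theorem derivedSet_eq :
    F.derivedSet = {x | ¬IsOpen[F.uniformSpace.toTopologicalSpace] {x}} := by
  ext x
  rw [derivedSet, F.topology_eq]
  constructor
  · intro h hx
    obtain ⟨y, hy, hne⟩ := h {x} hx rfl
    exact hne hy
  · intro h U hU hxU
    by_contra! hne
    exact h (by rwa [← eq_singleton_iff_unique_mem.2 ⟨hxU, hne⟩])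

end FuzzyMetric

/-- A fuzzy metric space is Lebesgue iff the set `X'` of accumulation points is compact
and, for every `r ∈ (0,1)` and `s > 0`, `X \ B(X',r,s)` is fuzzy uniformly discrete. -/
theorem lebesgue_iff_derivedSet_compact {X : Type*} [Nonempty X] (F : FuzzyMetric X) :
    F.Lebesgue ↔
      (@IsCompact X F.topology F.derivedSet ∧
        ∀ r ∈ Set.Ioo (0:ℝ) 1, ∀ s > (0:ℝ),
          F.UniformlyDiscrete ((⋃ a ∈ F.derivedSet, F.ball a r s)ᶜ)) := by
  let := F.uniformSpace
  have := F.t0Space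
  have := F.isCountablyGenerated_uniformity
  rw [F.lebesgue_iff, lebesgue_iff_isCompact_setOf_not_isOpen_singleton, F.topology_eq,
    F.derivedSet_eq]
  refine and_congr_right fun _ => ⟨fun h r hr s hs => ?_, fun h V hV => ?_⟩
  · exact (F.uniformlyDiscrete_iff _).2
      (h _ (F.hasBasis_uniformity.mem_of_mem (i := (r, s)) ⟨hr, hs⟩))
  · obtain ⟨⟨r, s⟩, ⟨hr, hs⟩, hrs⟩ := F.hasBasis_uniformity.mem_iff.1 hV
    obtain ⟨W, hW, hWd⟩ := (F.uniformlyDiscrete_iff _).1 (h r hr s hs)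
    have hsub := compl_subset_compl.2 (iUnion₂_mono
      fun a (_ : a ∈ {x : X | ¬IsOpen {x}}) =>
        (fun y hy => hrs hy : F.ball a r s ⊆ UniformSpace.ball a V))
    exact ⟨W, hW, fun x hx y hy => hWd x (hsub hx) y (hsub hy)⟩
end
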